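/- In a finite game that has at least one correlated equilibrium, LP strong duality holds for the optimal-CE linear program: sup{Σ_{s∈S} x_s w_s : x a correlated equilibrium} = inf{max_{s∈S} ŵ_s(y) : y a family of reals with all y^p_{i,j} ≥ 0}, and both the supremum and the infimum are attained. -/

import Mathlib

open Finset

noncomputable section

variable {N : Type} [Fintype N] [DecidableEq N]
variable {S : N → Type} [∀ p, Fintype (S p)] [∀ p, DecidableEq (S p)]

/-- Social welfare of a pure strategy profile: the sum of the players' utilities. -/
def socialWelfare (u : (p : N) → ((q : N) → S q) → ℝ) (s : (q : N) → S q) : ℝ :=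
  ∑ p, u p s

/-- A correlated distribution: a nonnegative function on pure profiles summing to one. -/
def IsCorrDist (x : ((q : N) → S q) → ℝ) : Prop :=
  (∀ s, 0 ≤ x s) ∧ ∑ s, x s = 1

/-- A correlated equilibrium. -/
def IsCE (u : (p : N) → ((q : N) → S q) → ℝ) (x : ((q : N) → S q) → ℝ) : Prop :=
  IsCorrDist x ∧ ∀ (p : N) (i j : S p),
    0 ≤ ∑ s ∈ Finset.univ.filter (fun s : (q : N) → S q => s p = i),
          (u p s - u p (Function.update s p j)) * x s

/-- A coarse correlated equilibrium. -/
def IsCCE (u : (p : N) → ((q : N) → S q) → ℝ) (x : ((q : N) → S q) → ℝ) : Prop :=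
  IsCorrDist x ∧ ∀ (p : N) (j : S p),
    0 ≤ ∑ s : (q : N) → S q, (u p s - u p (Function.update s p j)) * x s

/-- Deviation-adjusted utility of player `p` at profile `s`, given multipliers `y`. -/
def devAdjU (u : (p : N) → ((q : N) → S q) → ℝ) (y : (p : N) → S p → S p → ℝ)
    (p : N) (s : (q : N) → S q) : ℝ :=
  u p s + ∑ j : S p, y p (s p) j * (u p s - u p (Function.update s p j))

/-- Deviation-adjusted social welfare. -/
def devAdjSW (u : (p : N) → ((q : N) → S q) → ℝ) (y : (p : N) → S p → S p → ℝ)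
    (s : (q : N) → S q) : ℝ :=
  ∑ p, devAdjU u y p s

/-- Coarse deviation-adjusted utility of player `p` at profile `s`. -/
def cDevAdjU (u : (p : N) → ((q : N) → S q) → ℝ) (y : (p : N) → S p → ℝ)
    (p : N) (s : (q : N) → S q) : ℝ :=
  u p s + ∑ j : S p, y p j * (u p s - u p (Function.update s p j))

/-- Coarse deviation-adjusted social welfare. -/
def cDevAdjSW (u : (p : N) → ((q : N) → S q) → ℝ) (y : (p : N) → S p → ℝ)
    (s : (q : N) → S q) : ℝ :=
  ∑ p, cDevAdjU u y p s

/-- Weighted deviation-adjusted utility of player `p` at profile `s`. -/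
def wDevAdjU (u : (p : N) → ((q : N) → S q) → ℝ) (y : (p : N) → S p → S p → ℝ)
    (v : N → ℝ) (p : N) (s : (q : N) → S q) : ℝ :=
  v p * u p s + ∑ j : S p, y p (s p) j * (u p s - u p (Function.update s p j))

/-- Weighted deviation-adjusted social welfare. -/
def wDevAdjSW (u : (p : N) → ((q : N) → S q) → ℝ) (y : (p : N) → S p → S p → ℝ)
    (v : N → ℝ) (s : (q : N) → S q) : ℝ :=
  ∑ p, wDevAdjU u y v p s

/-- Number of players choosing action `α` under profile `s`. -/
def count {N A : Type} [Fintype N] [DecidableEq A] (s : N → A) (α : A) : ℕ :=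
  (Finset.univ.filter (fun p => s p = α)).card

/-- **Farkas' lemma** over a finite index set, for linear functionals on an arbitrary space. -/
theorem exists_nonneg_combination_of_nonneg_imp {ι V : Type*} [AddCommGroup V] [Module ℝ V]
    (t : Finset ι) (a : ι → V →ₗ[ℝ] ℝ) (b : V →ₗ[ℝ] ℝ)
    (h : ∀ x, (∀ i ∈ t, 0 ≤ a i x) → 0 ≤ b x) :
    ∃ c : ι → ℝ, (∀ i, 0 ≤ c i) ∧ b = ∑ i ∈ t, c i • a i := by
  classical
  induction t using Finset.induction_on generalizing a b with
  | empty =>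
    refine ⟨0, fun _ => le_rfl, LinearMap.ext fun x => le_antisymm ?_ ?_⟩
    · simpa using h (-x) (by simp)
    · simpa using h x (by simp)
  | insert k t hk ih =>
    have hupdate (c : ι → ℝ) (r : ℝ) :
        ∑ i ∈ insert k t, Function.update c k r i • a i = r • a k + ∑ i ∈ t, c i • a i := by
      rw [Finset.sum_insert hk, Function.update_self]
      congr 1
      refine Finset.sum_congr rfl fun i hi => ?_
      rw [Function.update_of_ne (ne_of_mem_of_not_mem hi hk)]
    by_cases hb : ∀ x, (∀ i ∈ t, 0 ≤ a i x) → 0 ≤ b x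
    · obtain ⟨c, hc, hbc⟩ := ih a b hb
      refine ⟨Function.update c k 0, fun i => ?_, ?_⟩
      · rcases eq_or_ne i k with rfl | hi
        · simp
        · simpa [hi] using hc i
      · rw [hupdate, hbc, zero_smul, zero_add]
    · push Not at hb
      obtain ⟨z, hz, hbz⟩ := hb
      have hkz : a k z < 0 := by
        by_contra! hkz
        exact hbz.not_ge (h z (by simpa [hkz] using hz))
      -- Project along `z` onto the kernel of `a k` and apply the induction hypothesis there
      obtain ⟨c, hc, hbc⟩ := ih (fun i => a i - (a i z / a k z) • a k)
        (b - (b z / a k z) • a k) fun x hx => by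
          have key : ∀ f : V →ₗ[ℝ] ℝ,
              f (x - (a k x / a k z) • z) = (f - (f z / a k z) • a k) x := fun f => by
            simp only [map_sub, map_smul, smul_eq_mul, LinearMap.sub_apply,
              LinearMap.smul_apply]
            ring
          rw [← key]
          refine h _ fun i hi => ?_
          rw [key]
          rcases Finset.mem_insert.1 hi with rfl | hi
          · simp [hkz.ne]
          · exact hx i hi
      refine ⟨Function.update c k (b z / a k z - ∑ i ∈ t, c i * (a i z / a k z)),
        fun i => ?_, ?_⟩
      · rcases eq_or_ne i k with rfl | hi
        · have h₁ : 0 ≤ b z / a i z := div_nonneg_of_nonpos hbz.le hkz.le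
          have h₂ : ∑ j ∈ t, c j * (a j z / a i z) ≤ 0 := Finset.sum_nonpos fun j hj =>
            mul_nonpos_of_nonneg_of_nonpos (hc j)
              (div_nonpos_of_nonneg_of_nonpos (hz j hj) hkz.le)
          simp only [Function.update_self]
          linarith
        · simpa [hi] using hc i
      · refine (eq_add_of_sub_eq hbc).trans ?_
        rw [hupdate]
        ext x
        simp only [LinearMap.add_apply, LinearMap.sub_apply, LinearMap.sum_apply,
          LinearMap.smul_apply, smul_eq_mul, mul_sub, Finset.sum_sub_distrib, sub_mul,
          Finset.sum_mul, mul_assoc]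
        ring

/-- The incentive to follow the recommendation `i` rather than deviate to `j`, as a linear
functional of the distribution. -/
def ceSlack (u : (p : N) → ((q : N) → S q) → ℝ) (p : N) (i j : S p) :
    (((q : N) → S q) → ℝ) →ₗ[ℝ] ℝ :=
  ∑ s ∈ Finset.univ.filter (fun s : (q : N) → S q => s p = i),
    (u p s - u p (Function.update s p j)) • LinearMap.proj s

theorem ceSlack_apply (u : (p : N) → ((q : N) → S q) → ℝ) (p : N) (i j : S p)
    (x : ((q : N) → S q) → ℝ) :
    ceSlack u p i j x = ∑ s ∈ Finset.univ.filter (fun s : (q : N) → S q => s p = i),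
      (u p s - u p (Function.update s p j)) * x s := by
  simp [ceSlack, LinearMap.sum_apply]

theorem isCE_iff_ceSlack_nonneg (u : (p : N) → ((q : N) → S q) → ℝ)
    (x : ((q : N) → S q) → ℝ) :
    IsCE u x ↔ x ∈ stdSimplex ℝ ((q : N) → S q) ∧ ∀ p (i j : S p), 0 ≤ ceSlack u p i j x := by
  simp only [IsCE, IsCorrDist, ceSlack_apply]
  rfl

theorem isCompact_setOf_isCE (u : (p : N) → ((q : N) → S q) → ℝ) :
    IsCompact {x | IsCE u x} := by
  have : {x | IsCE u x} = stdSimplex ℝ ((q : N) → S q) ∩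
      ⋂ (p : N) (i : S p) (j : S p), {x | 0 ≤ ceSlack u p i j x} := by
    ext x
    simp [isCE_iff_ceSlack_nonneg]
  rw [this]
  exact (isCompact_stdSimplex ℝ _).inter_right <| isClosed_iInter fun p =>
    isClosed_iInter fun i => isClosed_iInter fun j =>
      isClosed_le continuous_const (ceSlack u p i j).continuous_of_finiteDimensional

/-- Averaging the deviation-adjusted welfare gives the Lagrangian of the optimal-CE program. -/
theorem sum_mul_devAdjSW (u : (p : N) → ((q : N) → S q) → ℝ) (y : (p : N) → S p → S p → ℝ)
    (x : ((q : N) → S q) → ℝ) :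
    ∑ s, x s * devAdjSW u y s =
      ∑ s, x s * socialWelfare u s + ∑ p, ∑ i, ∑ j, y p i j * ceSlack u p i j x := by
  have h (p : N) : ∑ i, ∑ j, y p i j * ceSlack u p i j x =
      ∑ s, ∑ j, x s * (y p (s p) j * (u p s - u p (Function.update s p j))) := by
    rw [← Finset.sum_fiberwise Finset.univ (fun s : (q : N) → S q => s p)]
    refine Finset.sum_congr rfl fun i _ => ?_
    rw [Finset.sum_comm]
    refine Finset.sum_congr rfl fun j _ => ?_
    rw [ceSlack_apply, Finset.mul_sum]
    refine Finset.sum_congr rfl fun s hs => ?_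
    rw [(Finset.mem_filter.1 hs).2]
    ring
  simp only [h]
  rw [Finset.sum_comm, ← Finset.sum_add_distrib]
  refine Finset.sum_congr rfl fun s _ => ?_
  simp only [devAdjSW, devAdjU, socialWelfare, Finset.sum_add_distrib, mul_add, Finset.mul_sum]

/-- Weak duality for the optimal-CE program. -/
theorem IsCE.sum_mul_socialWelfare_le [∀ p, Nonempty (S p)]
    {u : (p : N) → ((q : N) → S q) → ℝ} {x : ((q : N) → S q) → ℝ} (hx : IsCE u x)
    {y : (p : N) → S p → S p → ℝ} (hy : ∀ (p : N) (i j : S p), 0 ≤ y p i j) :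
    ∑ s, x s * socialWelfare u s ≤
      Finset.univ.sup' Finset.univ_nonempty (fun s : (q : N) → S q => devAdjSW u y s) := by
  have hslack := ((isCE_iff_ceSlack_nonneg u x).1 hx).2
  calc ∑ s, x s * socialWelfare u s
      ≤ ∑ s, x s * devAdjSW u y s := by
        rw [sum_mul_devAdjSW, le_add_iff_nonneg_right]
        exact Finset.sum_nonneg fun p _ => Finset.sum_nonneg fun i _ =>
          Finset.sum_nonneg fun j _ => mul_nonneg (hy p i j) (hslack p i j)
    _ ≤ ∑ s, x s * Finset.univ.sup' Finset.univ_nonempty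
          (fun s : (q : N) → S q => devAdjSW u y s) :=
        Finset.sum_le_sum fun s _ => mul_le_mul_of_nonneg_left
          (Finset.le_sup' (fun s : (q : N) → S q => devAdjSW u y s) (Finset.mem_univ s))
          (hx.1.1 s)
    _ = _ := by rw [← Finset.sum_mul, hx.1.2, one_mul]

/-- A bound on the welfare of all correlated equilibria is certified by nonnegative multipliers. -/
theorem exists_devAdjSW_le_of_forall_isCE (u : (p : N) → ((q : N) → S q) → ℝ) (v : ℝ)
    (hv : ∀ x, IsCE u x → ∑ s, x s * socialWelfare u s ≤ v) :
    ∃ y : (p : N) → S p → S p → ℝ, (∀ (p : N) (i j : S p), 0 ≤ y p i j) ∧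
      ∀ s, devAdjSW u y s ≤ v := by
  obtain ⟨c, hc, hcomb⟩ := exists_nonneg_combination_of_nonneg_imp Finset.univ
    (Sum.elim (fun s => LinearMap.proj s) (fun k => ceSlack u k.1 k.2.1 k.2.2) :
      ((q : N) → S q) ⊕ (Σ p, S p × S p) → (((q : N) → S q) → ℝ) →ₗ[ℝ] ℝ)
    (∑ s, (v - socialWelfare u s) • LinearMap.proj s) fun x hx => by
      have hx₀ (s) : 0 ≤ x s := hx (.inl s) (Finset.mem_univ _)
      have hslack (p) (i j : S p) : 0 ≤ ceSlack u p i j x :=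
        hx (.inr ⟨p, i, j⟩) (Finset.mem_univ _)
      simp only [LinearMap.sum_apply, LinearMap.smul_apply, LinearMap.proj_apply, smul_eq_mul]
      rcases (Finset.sum_nonneg fun s _ => hx₀ s).eq_or_lt with h | h
      · have hzero := (Finset.sum_eq_zero_iff_of_nonneg fun s _ => hx₀ s).1 h.symm
        exact (Finset.sum_eq_zero fun s hs => by rw [hzero s hs, mul_zero]).ge
      · have hCE : IsCE u ((∑ s, x s)⁻¹ • x) := by
          refine (isCE_iff_ceSlack_nonneg u _).2 ⟨⟨fun s => ?_, ?_⟩, fun p i j => ?_⟩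
          · exact mul_nonneg (inv_nonneg.2 h.le) (hx₀ s)
          · simp only [Pi.smul_apply, smul_eq_mul, ← Finset.mul_sum]
            exact inv_mul_cancel₀ h.ne'
          · rw [map_smul]
            exact mul_nonneg (inv_nonneg.2 h.le) (hslack p i j)
        have := hv _ hCE
        simp only [Pi.smul_apply, smul_eq_mul, mul_assoc, ← Finset.mul_sum] at this
        rw [inv_mul_le_iff₀ h, Finset.sum_mul] at this
        rw [← sub_nonneg, ← Finset.sum_sub_distrib] at this
        exact this.trans_eq (Finset.sum_congr rfl fun s _ => by ring)
  refine ⟨fun p i j => c (.inr ⟨p, i, j⟩), fun p i j => hc _, fun s => ?_⟩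
  have hs := LinearMap.congr_fun hcomb (Pi.single s 1)
  have hL := sum_mul_devAdjSW u (fun p i j => c (.inr ⟨p, i, j⟩)) (Pi.single s 1)
  simp [LinearMap.sum_apply, Fintype.sum_sum_type, Fintype.sum_sigma, Fintype.sum_prod_type,
    Pi.single_apply] at hs hL
  linarith [hc (.inl s)]

/-- strong LP duality for the optimal-CE linear program: if the game has
a correlated equilibrium, there is a correlated equilibrium `x` attaining the maximum
expected social welfare, and a nonnegative `y` attaining the minimum of
`max_s ŵ_s(y)`, with the two optimal values equal. -/
theorem optimal_ce_strong_duality [∀ p, Nonempty (S p)]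
    (u : (p : N) → ((q : N) → S q) → ℝ)
    (hex : ∃ x : ((q : N) → S q) → ℝ, IsCE u x) :
    ∃ (x : ((q : N) → S q) → ℝ) (y : (p : N) → S p → S p → ℝ),
      IsCE u x ∧ (∀ (p : N) (i j : S p), 0 ≤ y p i j) ∧
      (∑ s, x s * socialWelfare u s =
        Finset.univ.sup' Finset.univ_nonempty
          (fun s : (q : N) → S q => devAdjSW u y s)) ∧
      (∀ x' : ((q : N) → S q) → ℝ, IsCE u x' →
        ∑ s, x' s * socialWelfare u s ≤ ∑ s, x s * socialWelfare u s) ∧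
      (∀ y' : (p : N) → S p → S p → ℝ, (∀ (p : N) (i j : S p), 0 ≤ y' p i j) →
        Finset.univ.sup' Finset.univ_nonempty
            (fun s : (q : N) → S q => devAdjSW u y s) ≤
          Finset.univ.sup' Finset.univ_nonempty
            (fun s : (q : N) → S q => devAdjSW u y' s)) := by
  obtain ⟨x, hx, hmax⟩ := (isCompact_setOf_isCE u).exists_isMaxOn hex
    (f := fun x => ∑ s, x s * socialWelfare u s) (by fun_prop)
  obtain ⟨y, hy, hle⟩ := exists_devAdjSW_le_of_forall_isCE u _ fun x' hx' => hmax hx'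
  have heq := (IsCE.sum_mul_socialWelfare_le hx hy).antisymm
    (Finset.sup'_le Finset.univ_nonempty _ fun s _ => hle s)
  exact ⟨x, y, hx, hy, heq, fun x' hx' => hmax hx',
    fun y' hy' => heq ▸ IsCE.sum_mul_socialWelfare_le hx hy'⟩
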